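/- Let G = ⟨x, y ∣ x³ = y⁵ = W(x,y)² = 1⟩ be a generalised triangle group of type (3,5,2) and let τ ∈ ℂ[λ] be the trace polynomial of W. If τ has a root λ₀ ∈ ℂ with λ₀ ∉ {0, 1, (1+√5)/2, (−1+√5)/2}, then G contains a subgroup isomorphic to the free group of rank 2. -/

import Mathlib

open Matrix Polynomial

/-- The generators `x`, `y` of the free group of rank 2. -/
def xgen : FreeGroup (Fin 2) := FreeGroup.of 0
def ygen : FreeGroup (Fin 2) := FreeGroup.of 1

/-- The word `W = x^{α(1)} y^{β(1)} ⋯ x^{α(k)} y^{β(k)}`. -/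
def Wword (k : ℕ) (a b : Fin k → ℕ) : FreeGroup (Fin 2) :=
  (List.ofFn fun i : Fin k => xgen ^ a i * ygen ^ b i).prod

/-- The relators `x³, y⁵, W²` of a generalised triangle group of type (3,5,2). -/
def triRels (k : ℕ) (a b : Fin k → ℕ) : Set (FreeGroup (Fin 2)) :=
  {xgen ^ 3, ygen ^ 5, (Wword k a b) ^ 2}

/-- The generalised triangle group `⟨x, y ∣ x³ = y⁵ = W² = 1⟩` of type (3,5,2). -/
abbrev TriGroup (k : ℕ) (a b : Fin k → ℕ) : Type := PresentedGroup (triRels k a b)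

/-- `W(X,Y)`: the image of a word `w ∈ F₂` under the homomorphism `F₂ → SL(2,ℂ)`
sending `x ↦ X` and `y ↦ Y`. -/
noncomputable def wEval (X Y : SpecialLinearGroup (Fin 2) ℂ) (w : FreeGroup (Fin 2)) :
    SpecialLinearGroup (Fin 2) ℂ :=
  FreeGroup.lift ![X, Y] w

/-- `τ` is a trace polynomial of `w` if `tr (w(X,Y)) = τ(tr (XY))` whenever
`tr X = 1` and `tr Y = (1+√5)/2`. -/
def IsTracePolynomial (w : FreeGroup (Fin 2)) (τ : Polynomial ℂ) : Prop :=
  ∀ X Y : SpecialLinearGroup (Fin 2) ℂ,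
    Matrix.trace (X : Matrix (Fin 2) (Fin 2) ℂ) = 1 →
    Matrix.trace (Y : Matrix (Fin 2) (Fin 2) ℂ) = (1 + (Real.sqrt 5 : ℂ)) / 2 →
    Matrix.trace ((wEval X Y w : SpecialLinearGroup (Fin 2) ℂ) : Matrix (Fin 2) (Fin 2) ℂ) =
      τ.eval (Matrix.trace ((X * Y : SpecialLinearGroup (Fin 2) ℂ) : Matrix (Fin 2) (Fin 2) ℂ))

namespace TriAux

/-- left multiplication by X on `A + B X + C Y + D XY` -/
def LX {R : Type*} [CommRing R] (x : R) (q : R × R × R × R) : R × R × R × R :=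
  (-q.2.1, q.1 + x * q.2.1, -q.2.2.2, q.2.2.1 + x * q.2.2.2)

/-- left multiplication by Y on `A + B X + C Y + D XY` -/
def LY {R : Type*} [CommRing R] (x y z : R) (q : R × R × R × R) : R × R × R × R :=
  ((z - x * y) * q.2.1 - q.2.2.1 - x * q.2.2.2, y * q.2.1 + q.2.2.2,
    q.1 + x * q.2.1 + y * q.2.2.1 + z * q.2.2.2, -q.2.1)

/-- coordinates of a word -/
def wQ {R : Type*} [CommRing R] (x y z : R) : List (ℕ × ℕ) → R × R × R × R
  | [] => (1, 0, 0, 0)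
  | s :: l => (LX x)^[s.1] ((LY x y z)^[s.2] (wQ x y z l))

/-- trace of a word -/
def trP {R : Type*} [CommRing R] (x y z : R) (l : List (ℕ × ℕ)) : R :=
  2 * (wQ x y z l).1 + (wQ x y z l).2.1 * x + (wQ x y z l).2.2.1 * y + (wQ x y z l).2.2.2 * z

/-- map of coordinates -/
def mQ {R S : Type*} [CommRing R] [CommRing S] (f : R →+* S) (q : R × R × R × R) :
    S × S × S × S := (f q.1, f q.2.1, f q.2.2.1, f q.2.2.2)

theorem mQ_wQ {R S : Type*} [CommRing R] [CommRing S] (f : R →+* S) (x y z : R)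
    (l : List (ℕ × ℕ)) : mQ f (wQ x y z l) = wQ (f x) (f y) (f z) l := by
  induction l with
  | nil => simp [wQ, mQ]
  | cons s l ih =>
    have h1 : Function.Semiconj (mQ f) (LX x) (LX (f x)) := by
      intro q; simp [mQ, LX]
    have h2 : Function.Semiconj (mQ f) (LY x y z) (LY (f x) (f y) (f z)) := by
      intro q; simp [mQ, LY]
    simp only [wQ]
    rw [(h1.iterate_right s.1).eq, (h2.iterate_right s.2).eq, ih]

theorem map_trP {R S : Type*} [CommRing R] [CommRing S] (f : R →+* S) (x y z : R)
    (l : List (ℕ × ℕ)) : f (trP x y z l) = trP (f x) (f y) (f z) l := by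
  have := mQ_wQ f x y z l
  simp only [trP, ← this, mQ, map_add, map_mul, map_ofNat]

/-- evaluate coordinates as a matrix -/
def evQ {R : Type*} [CommRing R] (X Y : Matrix (Fin 2) (Fin 2) R) (q : R × R × R × R) :
    Matrix (Fin 2) (Fin 2) R :=
  q.1 • 1 + q.2.1 • X + q.2.2.1 • Y + q.2.2.2 • (X * Y)

theorem ch {R : Type*} [CommRing R] (X : Matrix (Fin 2) (Fin 2) R) (h : X.det = 1) :
    X * X = X.trace • X - 1 := by
  rw [Matrix.det_fin_two] at h
  ext i j
  fin_cases i <;> fin_cases j <;>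
    simp [Matrix.mul_apply, Fin.sum_univ_two, Matrix.trace_fin_two] <;>
    first | ring1 | linear_combination h | linear_combination (-1) * h

theorem ch2 {R : Type*} [CommRing R] (X Y : Matrix (Fin 2) (Fin 2) R) :
    Y * X = - (X * Y) + X.trace • Y + Y.trace • X
      + ((X * Y).trace - X.trace * Y.trace) • 1 := by
  ext i j
  fin_cases i <;> fin_cases j <;>
    simp [Matrix.mul_apply, Fin.sum_univ_two, Matrix.trace_fin_two] <;> ring

theorem evX {R : Type*} [CommRing R] (X Y : Matrix (Fin 2) (Fin 2) R) (h : X.det = 1)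
    (q : R × R × R × R) : X * evQ X Y q = evQ X Y (LX X.trace q) := by
  simp only [evQ, LX, mul_add, Matrix.mul_smul, ← mul_assoc, ch X h, mul_one, sub_mul,
    Matrix.smul_mul, one_mul]
  module

theorem evY {R : Type*} [CommRing R] (X Y : Matrix (Fin 2) (Fin 2) R) (h : Y.det = 1)
    (q : R × R × R × R) :
    Y * evQ X Y q = evQ X Y (LY X.trace Y.trace (X * Y).trace q) := by
  have h3 : Y * X * Y = X - X.trace • 1 + (X * Y).trace • Y := by
    rw [ch2 X Y]
    simp only [add_mul, neg_mul, Matrix.smul_mul, one_mul, mul_assoc, ch Y h, mul_sub,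
      Matrix.mul_smul, mul_one]
    module
  simp only [evQ, LY, mul_add, Matrix.mul_smul, ← mul_assoc, h3, ch Y h, mul_one]
  rw [ch2 X Y]
  module

/-- the word as a matrix -/
def wM {R : Type*} [CommRing R] (X Y : Matrix (Fin 2) (Fin 2) R) : List (ℕ × ℕ) →
    Matrix (Fin 2) (Fin 2) R
  | [] => 1
  | s :: l => X ^ s.1 * Y ^ s.2 * wM X Y l

theorem wM_eq {R : Type*} [CommRing R] (X Y : Matrix (Fin 2) (Fin 2) R) (hX : X.det = 1)
    (hY : Y.det = 1) (l : List (ℕ × ℕ)) :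
    wM X Y l = evQ X Y (wQ X.trace Y.trace (X * Y).trace l) := by
  induction l with
  | nil => simp [wM, wQ, evQ]
  | cons s l ih =>
    have h1 : ∀ n q, X ^ n * evQ X Y q = evQ X Y ((LX X.trace)^[n] q) := by
      intro n
      induction n with
      | zero => simp
      | succ n ih => intro q; rw [pow_succ, mul_assoc, evX X Y hX, ih, Function.iterate_succ_apply]
    have h2 : ∀ n q, Y ^ n * evQ X Y q
        = evQ X Y ((LY X.trace Y.trace (X * Y).trace)^[n] q) := by
      intro n
      induction n with
      | zero => simp
      | succ n ih => intro q; rw [pow_succ, mul_assoc, evY X Y hY, ih, Function.iterate_succ_apply]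
    rw [wM, wQ, mul_assoc, ih, h2, h1]

theorem tr_wM {R : Type*} [CommRing R] (X Y : Matrix (Fin 2) (Fin 2) R) (hX : X.det = 1)
    (hY : Y.det = 1) (l : List (ℕ × ℕ)) :
    (wM X Y l).trace = trP X.trace Y.trace (X * Y).trace l := by
  rw [wM_eq X Y hX hY]
  simp only [evQ, trP, Matrix.trace_add, Matrix.trace_smul, Matrix.trace_one, smul_eq_mul,
    Fintype.card_fin]
  push_cast; ring

/-- syllables -/
def syl (k : ℕ) (a b : Fin k → ℕ) : List (ℕ × ℕ) := List.ofFn fun i => (a i, b i)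

theorem wEval_coe (k : ℕ) (a b : Fin k → ℕ) (X Y : SpecialLinearGroup (Fin 2) ℂ) :
    ((wEval X Y (Wword k a b) : SpecialLinearGroup (Fin 2) ℂ) : Matrix (Fin 2) (Fin 2) ℂ)
      = wM (X : Matrix (Fin 2) (Fin 2) ℂ) Y (syl k a b) := by
  have key : ∀ l : List (ℕ × ℕ),
      ((wEval X Y (l.map fun s => xgen ^ s.1 * ygen ^ s.2).prod :
        SpecialLinearGroup (Fin 2) ℂ) : Matrix (Fin 2) (Fin 2) ℂ)
      = wM (X : Matrix (Fin 2) (Fin 2) ℂ) Y l := by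
    intro l
    induction l with
    | nil => simp [wEval, wM]
    | cons s l ih =>
      rw [wM, ← ih]
      simp [wEval, xgen, ygen]
  rw [← key]
  simp [Wword, syl, List.map_ofFn, Function.comp_def]

theorem tr_wEval (k : ℕ) (a b : Fin k → ℕ) (X Y : SpecialLinearGroup (Fin 2) ℂ) :
    Matrix.trace ((wEval X Y (Wword k a b) : SpecialLinearGroup (Fin 2) ℂ) :
      Matrix (Fin 2) (Fin 2) ℂ) = trP (Matrix.trace (X : Matrix (Fin 2) (Fin 2) ℂ))
      (Matrix.trace (Y : Matrix (Fin 2) (Fin 2) ℂ))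
      (Matrix.trace ((X * Y : SpecialLinearGroup (Fin 2) ℂ) : Matrix (Fin 2) (Fin 2) ℂ))
      (syl k a b) := by
  rw [wEval_coe, tr_wM _ _ X.2 Y.2]
  simp

end TriAux
namespace TriAux

theorem core {a b c d p q : ℂ} {M m R : ℝ} (ha : ‖a‖ ≤ M) (hb : ‖b‖ ≤ M) (hd : ‖d‖ ≤ M)
    (hc : m ≤ ‖c‖) (hR : 1 ≤ R) (hRm : 3 * M ≤ R * m) (hpq : R * ‖q‖ < ‖p‖) :
    ‖a * p + b * q‖ ≤ R * ‖c * p + d * q‖ := by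
  have hM : 0 ≤ M := (norm_nonneg a).trans ha
  have hq : ‖q‖ ≤ ‖p‖ := by nlinarith [norm_nonneg q]
  have h1 : ‖a * p + b * q‖ ≤ M * ‖p‖ + M * ‖p‖ := by
    refine (norm_add_le _ _).trans ?_
    rw [norm_mul, norm_mul]
    gcongr
  have h2 : m * ‖p‖ - M * ‖q‖ ≤ ‖c * p + d * q‖ := by
    have := norm_sub_le (c * p + d * q) (d * q)
    rw [add_sub_cancel_right, norm_mul, norm_mul] at this
    have e1 : m * ‖p‖ ≤ ‖c‖ * ‖p‖ := by gcongr
    have e2 : ‖d‖ * ‖q‖ ≤ M * ‖q‖ := by gcongr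
    linarith
  have h3 : R * (m * ‖p‖ - M * ‖q‖) ≤ R * ‖c * p + d * q‖ := by gcongr
  have h4 : 3 * M * ‖p‖ ≤ R * m * ‖p‖ := by gcongr
  have h5 : M * (R * ‖q‖) ≤ M * ‖p‖ := by gcongr
  linarith

/-- attracting cone -/
def Ap (R : ℝ) : Set (SpecialLinearGroup (Fin 2) ℂ) := {m | R * ‖m 1 0‖ < ‖m 0 0‖}
/-- repelling cone -/
def Am (R : ℝ) : Set (SpecialLinearGroup (Fin 2) ℂ) := {m | R * ‖m 0 0‖ < ‖m 1 0‖}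

theorem Ap_Am {R : ℝ} (hR : 1 ≤ R) {m : SpecialLinearGroup (Fin 2) ℂ} (h : m ∈ Ap R)
    (h' : m ∈ Am R) : False := by
  simp only [Ap, Am, Set.mem_ofPred_eq] at h h'
  nlinarith [norm_nonneg (m 1 0), norm_nonneg (m 0 0)]

theorem col_ne (m : SpecialLinearGroup (Fin 2) ℂ) (h0 : m 0 0 = 0) (h1 : m 1 0 = 0) : False := by
  have := m.2
  rw [Matrix.det_fin_two] at this
  simp [h0, h1] at this

theorem mulc (g m : SpecialLinearGroup (Fin 2) ℂ) (i j : Fin 2) :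
    (g * m) i j = g i 0 * m 0 j + g i 1 * m 1 j := by
  simp [Matrix.mul_apply, Fin.sum_univ_two]

theorem diag_pow (g : SpecialLinearGroup (Fin 2) ℂ) (h01 : g 0 1 = 0) (h10 : g 1 0 = 0) (n : ℕ) :
    (g ^ n) 0 0 = (g 0 0) ^ n ∧ (g ^ n) 0 1 = 0 ∧ (g ^ n) 1 0 = 0 ∧ (g ^ n) 1 1 = (g 1 1) ^ n := by
  induction n with
  | zero => simp
  | succ n ih =>
    obtain ⟨h1, h2, h3, h4⟩ := ih
    simp only [pow_succ, mulc, h1, h2, h3, h4, h01, h10]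
    simp

theorem attract {R : ℝ} (hR : 1 ≤ R) (g m : SpecialLinearGroup (Fin 2) ℂ) {ν : ℂ}
    (hν : R < ‖ν‖) (h00 : g 0 0 = ν) (h01 : g 0 1 = 0) (h10 : g 1 0 = 0) (h11 : g 1 1 = ν⁻¹)
    (hm : m ∉ Am R) : g * m ∈ Ap R := by
  simp only [Ap, Am, Set.mem_ofPred_eq, mulc, h00, h01, h10, h11, not_lt] at hm ⊢
  simp only [zero_mul, add_zero, zero_add, norm_mul, norm_inv]
  have hp : 0 < ‖m 0 0‖ := by
    by_contra h
    have h0 : m 0 0 = 0 := by simpa using h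
    rw [h0] at hm
    have h1 : m 1 0 = 0 := by simpa using hm
    exact col_ne m h0 h1
  have hν0 : 0 < ‖ν‖ := by linarith
  rw [← mul_assoc, ← div_eq_mul_inv, div_mul_eq_mul_div, div_lt_iff₀ hν0]
  have e1 : R * ‖m 1 0‖ ≤ R * (R * ‖m 0 0‖) := by gcongr
  have e2 : R * R < ‖ν‖ * ‖ν‖ := by nlinarith
  nlinarith

theorem repel {R : ℝ} (hR : 1 ≤ R) (g m : SpecialLinearGroup (Fin 2) ℂ) {ν : ℂ}
    (hν : R < ‖ν‖) (h00 : g 0 0 = ν) (h01 : g 0 1 = 0) (h10 : g 1 0 = 0) (h11 : g 1 1 = ν⁻¹)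
    (hm : m ∉ Ap R) : g⁻¹ * m ∈ Am R := by
  by_contra h
  have := attract hR g _ hν h00 h01 h10 h11 h
  rw [mul_inv_cancel_left] at this
  exact hm this

theorem pingpong (g h : SpecialLinearGroup (Fin 2) ℂ) {μ : ℂ} (hμ : 1 < ‖μ‖)
    (h00 : g 0 0 = μ) (h01 : g 0 1 = 0) (h10 : g 1 0 = 0) (h11 : g 1 1 = μ⁻¹)
    (k00 : h 0 0 ≠ 0) (k01 : h 0 1 ≠ 0) (k10 : h 1 0 ≠ 0) (k11 : h 1 1 ≠ 0) :
    ∃ n : ℕ, Function.Injective (FreeGroup.lift ![g ^ n, h * g ^ n * h⁻¹]) := by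
  obtain ⟨M, hM1, hM2, hM3, hM4⟩ : ∃ M : ℝ, ‖h 0 0‖ ≤ M ∧ ‖h 0 1‖ ≤ M ∧ ‖h 1 0‖ ≤ M ∧ ‖h 1 1‖ ≤ M :=
    ⟨max (max ‖h 0 0‖ ‖h 0 1‖) (max ‖h 1 0‖ ‖h 1 1‖), by simp, by simp, by simp, by simp⟩
  obtain ⟨m, hm0, hm1, hm2, hm3, hm4⟩ : ∃ m : ℝ, 0 < m ∧ m ≤ ‖h 0 0‖ ∧ m ≤ ‖h 0 1‖ ∧
      m ≤ ‖h 1 0‖ ∧ m ≤ ‖h 1 1‖ :=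
    ⟨min (min ‖h 0 0‖ ‖h 0 1‖) (min ‖h 1 0‖ ‖h 1 1‖), by simp [*], by simp, by simp, by simp, by simp⟩
  obtain ⟨R, hR1, hR2⟩ : ∃ R : ℝ, 1 ≤ R ∧ 3 * M ≤ R * m :=
    ⟨max 1 (3 * M / m), le_max_left _ _, by
      rw [← div_le_iff₀ hm0]; exact le_max_right _ _⟩
  obtain ⟨n, hn⟩ := pow_unbounded_of_one_lt R hμ
  rw [← norm_pow] at hn
  obtain ⟨d1, d2, d3, d4⟩ := diag_pow g h01 h10 n
  rw [h00] at d1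
  rw [h11, inv_pow] at d4
  refine ⟨n, ?_⟩
  -- h moves both cones off both cones
  have mv1 : ∀ v ∈ Ap R, h * v ∉ Ap R ∧ h * v ∉ Am R := by
    intro v hv
    simp only [Ap, Am, Set.mem_ofPred_eq, mulc, not_lt] at hv ⊢
    exact ⟨core hM1 hM2 hM4 hm3 hR1 hR2 hv, core hM3 hM4 hM2 hm1 hR1 hR2 hv⟩
  have mv2 : ∀ v ∈ Am R, h * v ∉ Ap R ∧ h * v ∉ Am R := by
    intro v hv
    simp only [Ap, Am, Set.mem_ofPred_eq, mulc, not_lt] at hv ⊢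
    have e1 := core hM2 hM1 hM3 hm4 hR1 hR2 hv
    have e2 := core hM4 hM3 hM1 hm2 hR1 hR2 hv
    exact ⟨by simpa only [add_comm] using e1, by simpa only [add_comm] using e2⟩
  have mw1 : ∀ v, h⁻¹ * v ∈ Ap R → v ∉ Ap R ∧ v ∉ Am R := by
    intro v hv; simpa using mv1 _ hv
  have mw2 : ∀ v, h⁻¹ * v ∈ Am R → v ∉ Ap R ∧ v ∉ Am R := by
    intro v hv; simpa using mv2 _ hv
  refine FreeGroup.injective_lift_of_ping_pong _
    (![Ap R, {v | h⁻¹ * v ∈ Ap R}]) (![Am R, {v | h⁻¹ * v ∈ Am R}]) ?_ ?_ ?_ ?_ ?_ ?_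
  · have hne : (1 : SpecialLinearGroup (Fin 2) ℂ) ∈ Ap R := by simp [Ap]
    intro i; fin_cases i
    · exact ⟨1, hne⟩
    · exact ⟨h, by simpa using hne⟩
  · intro i j hij
    fin_cases i <;> fin_cases j <;> simp [Function.onFun, Set.disjoint_left] at hij ⊢
    · exact fun v h1 h2 => (mw1 v h2).1 h1
    · exact fun v h1 h2 => (mw1 v h1).1 h2
  · intro i j hij
    fin_cases i <;> fin_cases j <;> simp [Function.onFun, Set.disjoint_left] at hij ⊢
    · exact fun v h1 h2 => (mw2 v h2).2 h1
    · exact fun v h1 h2 => (mw2 v h1).2 h2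
  · intro i j
    fin_cases i <;> fin_cases j <;> simp [Set.disjoint_left]
    · exact fun v h1 h2 => Ap_Am hR1 h1 h2
    · exact fun v h1 h2 => (mw2 v h2).1 h1
    · exact fun v h1 h2 => (mw1 v h1).2 h2
    · exact fun v h1 h2 => Ap_Am hR1 h1 h2
  · intro i
    rintro _ ⟨v, hv, rfl⟩
    fin_cases i
    · exact attract hR1 _ v hn d1 d2 d3 d4 hv
    · have := attract hR1 _ (h⁻¹ * v) hn d1 d2 d3 d4 hv
      simpa [mul_assoc] using this
  · intro i
    rintro _ ⟨v, hv, rfl⟩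
    fin_cases i
    · exact repel hR1 _ v hn d1 d2 d3 d4 hv
    · have := repel hR1 _ (h⁻¹ * v) hn d1 d2 d3 d4 hv
      simpa [mul_assoc] using this

theorem center_sq (g : SpecialLinearGroup (Fin 2) ℂ) (hg : g ∈ Subgroup.center _) : g ^ 2 = 1 := by
  rw [Matrix.SpecialLinearGroup.mem_center_iff] at hg
  obtain ⟨r, hr, h⟩ := hg
  ext i j
  simp only [Fintype.card_fin] at hr
  rw [Matrix.SpecialLinearGroup.coe_pow, ← h, ← map_pow, hr, map_one]
  rfl

theorem free_lift (k : ℕ) (a b : Fin k → ℕ) (X Y : SpecialLinearGroup (Fin 2) ℂ)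
    (hX : X ^ 3 = -1) (hY : Y ^ 5 = -1) (hW : (wEval X Y (Wword k a b)) ^ 2 = -1)
    (u v : FreeGroup (Fin 2))
    (hinj : Function.Injective (FreeGroup.lift ![wEval X Y u, wEval X Y v])) :
    ∃ H : Subgroup (TriGroup k a b), Nonempty (H ≃* FreeGroup (Fin 2)) := by
  have hc : (-1 : SpecialLinearGroup (Fin 2) ℂ) ∈ Subgroup.center _ := by
    rw [Subgroup.mem_center_iff]; intro g; simp
  have hN : Subgroup.normalClosure (triRels k a b) ≤
      (Subgroup.center (SpecialLinearGroup (Fin 2) ℂ)).comap (FreeGroup.lift ![X, Y]) := by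
    apply Subgroup.normalClosure_le_normal
    intro r hr
    simp only [triRels, Set.mem_insert_iff, Set.mem_singleton_iff] at hr
    simp only [SetLike.mem_coe, Subgroup.mem_comap]
    rcases hr with rfl | rfl | rfl
    · simpa [xgen, hX] using hc
    · simpa [ygen, hY] using hc
    · rw [map_pow]; unfold wEval at hW; rw [hW]; exact hc
  let f : FreeGroup (Fin 2) →* TriGroup k a b :=
    (PresentedGroup.mk (triRels k a b)).comp (FreeGroup.lift ![u, v])
  have hf : Function.Injective f := by
    rw [injective_iff_map_eq_one]
    intro w hw
    have h1 : FreeGroup.lift ![u, v] w ∈ Subgroup.normalClosure (triRels k a b) :=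
      PresentedGroup.mk_eq_one_iff.mp hw
    have h2 := center_sq _ (hN h1)
    have h3 : (FreeGroup.lift ![X, Y]).comp (FreeGroup.lift ![u, v])
        = FreeGroup.lift ![wEval X Y u, wEval X Y v] := by
      apply FreeGroup.ext_hom
      intro i
      fin_cases i <;> simp [wEval]
    have h4 : FreeGroup.lift ![wEval X Y u, wEval X Y v] (w ^ 2) = 1 := by
      rw [← h3, map_pow]; exact h2
    have h5 : w ^ 2 = 1 := hinj (by rw [h4, map_one])
    exact (pow_eq_one_iff_left (by norm_num)).mp h5
  exact ⟨f.range, ⟨(MonoidHom.ofInjective hf).symm⟩⟩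

end TriAux
namespace TriAux

/-- left multiplication by `(X - e)(u Y - v)` when `x = 1` -/
def sylF {R : Type*} [CommRing R] (y z e u v : R) (q : R × R × R × R) : R × R × R × R :=
  (-(u * (y * q.2.1 + q.2.2.2) - v * q.2.1)
      - e * (u * ((z - y) * q.2.1 - q.2.2.1 - q.2.2.2) - v * q.1),
   (u * (z * q.2.1 - q.2.2.1) - v * (q.1 + q.2.1))
      - e * (u * (y * q.2.1 + q.2.2.2) - v * q.2.1),
   (u * q.2.1 + v * q.2.2.2)
      - e * (u * (q.1 + q.2.1 + y * q.2.2.1 + z * q.2.2.2) - v * q.2.2.1),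
   u * (q.1 + y * q.2.2.1 + z * q.2.2.2) - v * (q.2.2.1 + q.2.2.2) + e * u * q.2.1
      + e * v * q.2.2.2)

theorem syl_eq {R : Type*} [CommRing R] (y z : R) (hy : y ^ 2 = y + 1) (m n : ℕ)
    (hm : 0 < m ∧ m < 3) (hn : 0 < n ∧ n < 5) :
    ∃ e u v : R, (e = 0 ∨ e = 1) ∧ (u = 1 ∨ u = y) ∧ (v = 0 ∨ v = 1 ∨ v = y) ∧
      ∀ q, (LX 1)^[m] ((LY 1 y z)^[n] q) = sylF y z e u v q := by
  obtain ⟨e, he, hX⟩ : ∃ e : R, (e = 0 ∨ e = 1) ∧ ∀ q : R × R × R × R,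
      (LX 1)^[m] q = LX 1 q - e • q := by
    obtain ⟨h1, h2⟩ := hm
    interval_cases m
    · exact ⟨0, by simp, fun q => by simp⟩
    · refine ⟨1, by simp, fun q => ?_⟩
      ext <;> simp [LX] <;> ring
  obtain ⟨u, v, hu, hv, hY⟩ : ∃ u v : R, (u = 1 ∨ u = y) ∧ (v = 0 ∨ v = 1 ∨ v = y) ∧
      ∀ q : R × R × R × R, (LY 1 y z)^[n] q = u • LY 1 y z q - v • q := by
    obtain ⟨h1, h2⟩ := hn
    have k2 : ∀ q : R × R × R × R, LY 1 y z (LY 1 y z q) = y • LY 1 y z q - q := by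
      intro q
      ext <;> simp [LY] <;> ring
    have kl : ∀ (s t : R) (q r : R × R × R × R), LY 1 y z (s • q - t • r)
        = s • LY 1 y z q - t • LY 1 y z r := by
      intro s t q r
      ext <;> simp [LY] <;> ring
    have k3 : ∀ q : R × R × R × R, LY 1 y z (LY 1 y z (LY 1 y z q)) = y • LY 1 y z q - y • q := by
      intro q
      rw [k2 (LY 1 y z q), k2, smul_sub, smul_smul, ← pow_two, hy]
      module
    interval_cases n
    · exact ⟨1, 0, by simp, by simp, fun q => by simp⟩
    · refine ⟨y, 1, by simp, by simp, fun q => ?_⟩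
      simp only [Function.iterate_succ, Function.comp, Function.iterate_zero, id, k2, one_smul]
    · refine ⟨y, y, by simp, by simp, fun q => ?_⟩
      simp only [Function.iterate_succ, Function.comp, Function.iterate_zero, id, k3]
    · refine ⟨1, y, by simp, by simp, fun q => ?_⟩
      have e4 : LY 1 y z (LY 1 y z (LY 1 y z (LY 1 y z q))) = 1 • LY 1 y z q - y • q := by
        rw [k3 (LY 1 y z q), k2, smul_sub, smul_smul, ← pow_two, hy]
        module
      simp only [Function.iterate_succ, Function.comp, Function.iterate_zero, id, e4, one_smul]
  refine ⟨e, u, v, he, hu, hv, fun q => ?_⟩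
  rw [hX, hY]
  ext <;> simp [LX, LY, sylF] <;> ring

theorem deg_wQ {S : Type*} [CommRing S] (y : S) (hy : y ^ 2 = y + 1) (l : List (ℕ × ℕ))
    (hl : ∀ s ∈ l, (0 < s.1 ∧ s.1 < 3) ∧ (0 < s.2 ∧ s.2 < 5)) (hne : l ≠ []) :
    (wQ (1 : S[X]) (C y) X l).1.natDegree ≤ l.length - 1 ∧
    (wQ (1 : S[X]) (C y) X l).2.1.natDegree ≤ l.length - 1 ∧
    (wQ (1 : S[X]) (C y) X l).2.2.1.natDegree ≤ l.length - 1 ∧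
    (wQ (1 : S[X]) (C y) X l).2.2.2.natDegree ≤ l.length - 1 ∧
    IsUnit ((wQ (1 : S[X]) (C y) X l).2.2.2.coeff (l.length - 1)) := by
  have hyu : IsUnit y := IsUnit.of_mul_eq_one (y - 1) (by linear_combination hy)
  induction l with
  | nil => exact absurd rfl hne
  | cons s l ih =>
    have hs := hl s (by simp)
    obtain ⟨e, u, v, he, hu, hv, hq⟩ := syl_eq (C y : S[X]) X (by rw [← C_pow, hy]; simp)
      s.1 s.2 hs.1 hs.2
    obtain ⟨e, rfl⟩ : ∃ e' : S, e = C e' := by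
      rcases he with h | h
      · exact ⟨0, by simp [h]⟩
      · exact ⟨1, by simp [h]⟩
    obtain ⟨u, rfl, huu⟩ : ∃ u' : S, u = C u' ∧ IsUnit u' := by
      rcases hu with h | h
      · exact ⟨1, by simp [h]⟩
      · exact ⟨y, h, hyu⟩
    obtain ⟨v, rfl⟩ : ∃ v' : S, v = C v' := by
      rcases hv with h | h | h
      · exact ⟨0, by simp [h]⟩
      · exact ⟨1, by simp [h]⟩
      · exact ⟨y, h⟩
    have hw : wQ (1 : S[X]) (C y) X (s :: l) = sylF (C y) X (C e) (C u) (C v)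
      (wQ (1 : S[X]) (C y) X l) := by rw [wQ, hq]
    rw [hw]
    by_cases hl0 : l = []
    · subst hl0
      simp only [sylF, wQ, List.length_singleton]
      refine ⟨?_, ?_, ?_, ?_, ?_⟩
      · rw [natDegree_le_iff_coeff_eq_zero]; intro N hN
        simp [coeff_C, (show N ≠ 0 by omega)]
      · simp
      · rw [natDegree_le_iff_coeff_eq_zero]; intro N hN
        simp [coeff_C, (show N ≠ 0 by omega)]
      · simp
      · simpa using huu
    · obtain ⟨i1, i2, i3, i4, i5⟩ := ih (fun s hs => hl s (by simp [hs])) hl0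
      have hlen : 0 < l.length := List.length_pos_iff.mpr hl0
      obtain ⟨n, hn⟩ : ∃ n, l.length = n + 1 := ⟨l.length - 1, by omega⟩
      simp only [List.length_cons, hn, Nat.add_sub_cancel] at i1 i2 i3 i4 i5 ⊢
      generalize wQ (1 : S[X]) (C y) X l = q at *
      obtain ⟨A, B, D, E⟩ := q
      simp only at i1 i2 i3 i4 i5
      have cz : ∀ p : S[X], p.natDegree ≤ n → ∀ N, n < N → p.coeff N = 0 :=
        fun p hp N hN => coeff_eq_zero_of_natDegree_lt (by omega)
      have xz : ∀ p : S[X], p.natDegree ≤ n → ∀ N, n + 1 < N → (X * p).coeff N = 0 := by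
        intro p hp N hN
        obtain ⟨N, rfl⟩ : ∃ N', N = N' + 1 := ⟨N - 1, by omega⟩
        rw [coeff_X_mul]; exact cz p hp N (by omega)
      refine ⟨?_, ?_, ?_, ?_, ?_⟩
      · rw [natDegree_le_iff_coeff_eq_zero]; intro N hN
        simp [sylF, sub_mul, mul_assoc, cz _ i1 N (by omega), cz _ i2 N (by omega),
          cz _ i3 N (by omega), cz _ i4 N (by omega), xz _ i2 N hN]
      · rw [natDegree_le_iff_coeff_eq_zero]; intro N hN
        simp [sylF, sub_mul, mul_assoc, cz _ i1 N (by omega), cz _ i2 N (by omega),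
          cz _ i3 N (by omega), cz _ i4 N (by omega), xz _ i2 N hN]
      · rw [natDegree_le_iff_coeff_eq_zero]; intro N hN
        simp [sylF, sub_mul, mul_assoc, cz _ i1 N (by omega), cz _ i2 N (by omega),
          cz _ i3 N (by omega), cz _ i4 N (by omega), xz _ i4 N hN]
      · rw [natDegree_le_iff_coeff_eq_zero]; intro N hN
        simp [sylF, sub_mul, mul_assoc, cz _ i1 N (by omega), cz _ i2 N (by omega),
          cz _ i3 N (by omega), cz _ i4 N (by omega), xz _ i4 N hN]
      · have : (sylF (C y) X (C e) (C u) (C v) (A, B, D, E)).2.2.2.coeff (n + 1)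
            = u * E.coeff n := by
          simp [sylF, mul_assoc, cz _ i1 (n + 1) (by omega), cz _ i2 (n + 1) (by omega),
          cz _ i3 (n + 1) (by omega), cz _ i4 (n + 1) (by omega)]
        rw [this]
        exact huu.mul i5

theorem integral_root (y z : ℂ) (hy : y ^ 2 = y + 1) (l : List (ℕ × ℕ))
    (hl : ∀ s ∈ l, (0 < s.1 ∧ s.1 < 3) ∧ (0 < s.2 ∧ s.2 < 5)) (hne : l ≠ [])
    (h0 : trP 1 y z l = 0) : IsIntegral ℤ y ∧ IsIntegral ℤ z := by
  have hyi : IsIntegral ℤ y := by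
    refine ⟨X ^ 2 - X - 1, by monicity!, ?_⟩
    simp [hy]
  refine ⟨hyi, ?_⟩
  let S := integralClosure ℤ ℂ
  let y' : S := ⟨y, hyi⟩
  have hy' : y' ^ 2 = y' + 1 := Subtype.ext hy
  obtain ⟨i1, i2, i3, i4, i5⟩ := deg_wQ y' hy' l hl hne
  have hlen : 0 < l.length := List.length_pos_iff.mpr hne
  obtain ⟨n, hn⟩ : ∃ n, l.length = n + 1 := ⟨l.length - 1, by omega⟩
  simp only [hn, Nat.add_sub_cancel] at i1 i2 i3 i4 i5
  have hT : (aeval z : S[X] →ₐ[S] ℂ) (trP (1 : S[X]) (C y') X l) = 0 := by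
    have := map_trP (aeval z : S[X] →ₐ[S] ℂ).toRingHom 1 (C y') X l
    simp only [AlgHom.toRingHom_eq_coe, RingHom.coe_coe, map_one, aeval_X, aeval_C] at this
    rw [this]
    exact h0
  obtain ⟨w, hw⟩ := i5
  have hc1 : ∀ p : S[X], p.natDegree ≤ n → p.coeff (n + 1) = 0 :=
    fun p hp => coeff_eq_zero_of_natDegree_lt (by omega)
  have hcoef : (trP (1 : S[X]) (C y') X l).coeff (n + 1) = w := by
    have h2 : (2 : S[X]) = C 2 := rfl
    simp only [trP, mul_one, h2, coeff_add, coeff_C_mul, coeff_mul_C, coeff_mul_X, hc1 _ i1,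
      hc1 _ i2, hc1 _ i3, hw]
    simp
  have hdeg : (trP (1 : S[X]) (C y') X l).natDegree ≤ n + 1 := by
    rw [natDegree_le_iff_coeff_eq_zero]
    intro N hN
    obtain ⟨N, rfl⟩ : ∃ N', N = N' + 1 := ⟨N - 1, by omega⟩
    have h2 : (2 : S[X]) = C 2 := rfl
    have cz : ∀ p : S[X], p.natDegree ≤ n → ∀ N, n < N → p.coeff N = 0 :=
        fun p hp N hN => coeff_eq_zero_of_natDegree_lt (by omega)
    simp only [trP, mul_one, h2, coeff_add, coeff_C_mul, coeff_mul_C, coeff_mul_X]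
    rw [cz _ i1 _ (by omega), cz _ i2 _ (by omega), cz _ i3 _ (by omega), cz _ i4 _ (by omega)]
    simp
  have hint : IsIntegral S z := by
    refine ⟨C (↑w⁻¹ : S) * trP (1 : S[X]) (C y') X l, ?_, ?_⟩
    · apply monic_of_natDegree_le_of_coeff_eq_one (n + 1)
      · exact (natDegree_C_mul_le _ _).trans hdeg
      · rw [coeff_C_mul, hcoef]; simp
    · have : (aeval z : S[X] →ₐ[S] ℂ) (C (↑w⁻¹ : S) * trP (1 : S[X]) (C y') X l) = 0 := by
        rw [map_mul, hT, mul_zero]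
      exact this
  exact isIntegral_trans z hint

end TriAux
namespace TriAux

theorem slext (A B : SpecialLinearGroup (Fin 2) ℂ)
    (h : (A : Matrix (Fin 2) (Fin 2) ℂ) = (B : Matrix (Fin 2) (Fin 2) ℂ)) : A = B := Subtype.ext h

theorem finish (k : ℕ) (a b : Fin k → ℕ) (X Y : SpecialLinearGroup (Fin 2) ℂ) (y z : ℂ)
    (hy : y ^ 2 = y + 1)
    (tX : Matrix.trace (X : Matrix (Fin 2) (Fin 2) ℂ) = 1)
    (tY : Matrix.trace (Y : Matrix (Fin 2) (Fin 2) ℂ) = y)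
    (tXY : Matrix.trace ((X * Y : SpecialLinearGroup (Fin 2) ℂ) : Matrix (Fin 2) (Fin 2) ℂ) = z)
    (h0 : trP 1 y z (syl k a b) = 0) (w : FreeGroup (Fin 2)) (μ : ℂ) (hμ : 1 < ‖μ‖)
    (h00 : (wEval X Y w) 0 0 = μ) (h01 : (wEval X Y w) 0 1 = 0) (h10 : (wEval X Y w) 1 0 = 0)
    (h11 : (wEval X Y w) 1 1 = μ⁻¹)
    (k00 : X 0 0 ≠ 0) (k01 : X 0 1 ≠ 0) (k10 : X 1 0 ≠ 0) (k11 : X 1 1 ≠ 0) :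
    ∃ H : Subgroup (TriGroup k a b), Nonempty (H ≃* FreeGroup (Fin 2)) := by
  obtain ⟨n, hn⟩ := pingpong _ X hμ h00 h01 h10 h11 k00 k01 k10 k11
  have cX := ch (X : Matrix (Fin 2) (Fin 2) ℂ) X.2
  have cY := ch (Y : Matrix (Fin 2) (Fin 2) ℂ) Y.2
  have cW := ch ((wEval X Y (Wword k a b) : SpecialLinearGroup (Fin 2) ℂ) :
    Matrix (Fin 2) (Fin 2) ℂ) (wEval X Y (Wword k a b)).2
  rw [tr_wEval, tX, tY, tXY, h0] at cW
  rw [tX] at cX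
  rw [tY] at cY
  refine free_lift k a b X Y ?_ ?_ ?_ (w ^ n) (xgen * w ^ n * xgen⁻¹) ?_
  · apply slext
    rw [Matrix.SpecialLinearGroup.coe_pow, Matrix.SpecialLinearGroup.coe_neg, Matrix.SpecialLinearGroup.coe_one,
      pow_succ, pow_two, cX, sub_mul, one_smul, cX]
    simp
  · apply slext
    rw [Matrix.SpecialLinearGroup.coe_pow, Matrix.SpecialLinearGroup.coe_neg, Matrix.SpecialLinearGroup.coe_one]
    have c4 : (Y : Matrix (Fin 2) (Fin 2) ℂ) ^ 4 = Y - y • 1 := by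
      have : (Y : Matrix (Fin 2) (Fin 2) ℂ) ^ 4 = (Y * Y) * (Y * Y) := by
        rw [← pow_two, ← pow_two, ← pow_mul]
      rw [this, cY, sub_mul, mul_sub, mul_sub, Matrix.smul_mul, Matrix.mul_smul, cY]
      simp only [smul_sub, smul_smul, mul_one, one_mul]
      have e : y * (y * y) = 2 * y + 1 := by linear_combination (y + 1) * hy
      have e2 : y * y = y + 1 := by linear_combination hy
      rw [e, e2]
      module
    rw [pow_succ, c4, sub_mul, cY]
    simp
  · apply slext
    rw [Matrix.SpecialLinearGroup.coe_pow, Matrix.SpecialLinearGroup.coe_neg, Matrix.SpecialLinearGroup.coe_one,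
      pow_two, cW]
    simp
  · have e1 : wEval X Y (w ^ n) = wEval X Y w ^ n := by simp [wEval]
    have e2 : wEval X Y (xgen * w ^ n * xgen⁻¹) = X * wEval X Y w ^ n * X⁻¹ := by
      simp [wEval, xgen]
    rw [e1, e2]
    exact hn

theorem real_y (y : ℂ) (hy : y ^ 2 = y + 1) : ∃ t : ℝ, y = t ∧ t ^ 2 = t + 1 := by
  have h1 := congrArg Complex.re hy
  have h2 := congrArg Complex.im hy
  simp [pow_two] at h1 h2
  have him : y.im = 0 := by
    by_contra h
    have : y.re = 1 / 2 := by
      have : y.im * (2 * y.re - 1) = 0 := by linarith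
      rcases mul_eq_zero.mp this with h' | h'
      · exact absurd h' h
      · linarith
    rw [this] at h1
    nlinarith [mul_self_nonneg y.im]
  refine ⟨y.re, Complex.ext (by simp) (by simp [him]), ?_⟩
  rw [him] at h1
  linarith

theorem ex_quad (s : ℂ) : ∃ μ : ℂ, μ ≠ 0 ∧ μ + μ⁻¹ = s := by
  obtain ⟨r, hr⟩ := IsAlgClosed.exists_pow_nat_eq (s ^ 2 - 4) (n := 2) (by norm_num)
  have h : ((s + r) / 2) * ((s - r) / 2) = 1 := by linear_combination -hr / 4
  have h0 : (s + r) / 2 ≠ 0 := left_ne_zero_of_mul_eq_one h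
  refine ⟨(s + r) / 2, h0, ?_⟩
  rw [inv_eq_of_mul_eq_one_right h]
  ring

theorem norm_ne_of (μ : ℂ) (h : ‖μ‖ = 1) : (μ + μ⁻¹).im = 0 := by
  rw [Complex.inv_eq_conj h]; simp

theorem case_nonreal (k : ℕ) (a b : Fin k → ℕ) (y z : ℂ) (hy : y ^ 2 = y + 1)
    (h0 : trP 1 y z (syl k a b) = 0) (hz : z.im ≠ 0) :
    ∃ H : Subgroup (TriGroup k a b), Nonempty (H ≃* FreeGroup (Fin 2)) := by
  obtain ⟨μ, hμ0, hμz, hμ⟩ : ∃ μ : ℂ, μ ≠ 0 ∧ μ + μ⁻¹ = z ∧ 1 < ‖μ‖ := by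
    obtain ⟨μ, hμ0, hμ⟩ := ex_quad z
    rcases lt_trichotomy ‖μ‖ 1 with h | h | h
    · refine ⟨μ⁻¹, inv_ne_zero hμ0, by rw [inv_inv, add_comm, hμ], ?_⟩
      rw [norm_inv]
      exact (one_lt_inv₀ (norm_pos_iff.mpr hμ0)).mpr h
    · exact absurd (norm_ne_of μ h) (by rw [hμ]; exact hz)
    · exact ⟨μ, hμ0, hμ, h⟩
  obtain ⟨t, rfl, ht⟩ := real_y y hy
  have hμr : ∀ r : ℝ, μ ≠ r := by
    intro r hr
    apply hz
    rw [← hμz, hr, ← Complex.ofReal_inv, ← Complex.ofReal_add, Complex.ofReal_im]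
  have hne : μ - μ⁻¹ ≠ 0 := by
    intro h
    have h1 : μ * μ = 1 := by
      have := congrArg (· * μ) h
      simp only [sub_mul, inv_mul_cancel₀ hμ0, zero_mul] at this
      linear_combination this
    rcases mul_self_eq_one_iff.mp h1 with h | h
    · exact hμr 1 (by simp [h])
    · exact hμr (-1) (by simp [h])
  obtain ⟨d, hd⟩ : ∃ d : ℂ, d * (μ - μ⁻¹) = t - μ⁻¹ := ⟨(t - μ⁻¹) / (μ - μ⁻¹), div_mul_cancel₀ _ hne⟩
  let c : ℂ := (1 - d) * d - 1
  have hμi : μ * μ⁻¹ = 1 := mul_inv_cancel₀ hμ0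
  let P : SpecialLinearGroup (Fin 2) ℂ := ⟨!![1 - d, 1; c, d], by rw [Matrix.det_fin_two_of]; simp [c]⟩
  let Q : SpecialLinearGroup (Fin 2) ℂ := ⟨!![d * μ, -μ⁻¹; -c * μ, (1 - d) * μ⁻¹], by
    rw [Matrix.det_fin_two_of]
    linear_combination ((1 - d) * d - c) * hμi⟩
  have hXY : ((P * Q : SpecialLinearGroup (Fin 2) ℂ) : Matrix (Fin 2) (Fin 2) ℂ) = !![μ, 0; 0, μ⁻¹] := by
    rw [Matrix.SpecialLinearGroup.coe_mul]
    simp only [P, Q, Matrix.mul_fin_two]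
    ext i j
    fin_cases i <;> fin_cases j <;> simp [c] <;> ring
  have hw : wEval P Q (xgen * ygen) = P * Q := by simp [wEval, xgen, ygen]
  have hd2 : d * μ + (1 - d) * μ⁻¹ = t := by linear_combination hd
  refine finish k a b P Q t z hy ?_ ?_ ?_ h0 (xgen * ygen) μ hμ ?_ ?_ ?_ ?_ ?_ ?_ ?_ ?_
  · simp [P, Matrix.trace_fin_two]
  · simp only [Q, Matrix.trace_fin_two_of]; exact hd2
  · rw [hXY, Matrix.trace_fin_two_of, hμz]
  · rw [hw, hXY]; simp
  · rw [hw, hXY]; simp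
  · rw [hw, hXY]; simp
  · rw [hw, hXY]; simp
  · simp only [P]
    intro h
    have h1 : d = 1 := by simp at h; linear_combination -h
    rw [h1] at hd2
    exact hμr t (by linear_combination hd2)
  · simp [P]
  · simp only [P]
    intro h
    have h1 : c = 0 := by simpa using h
    have hdd : (1 - d) * d = 1 := by simpa [c, sub_eq_zero] using h1
    have hd3 : ‖d‖ = 1 := by
      have : d ^ 3 = -1 := by linear_combination (-1 - d) * hdd
      have h2 : ‖d‖ ^ 3 = 1 := by rw [← norm_pow, this]; simp
      exact (pow_eq_one_iff_of_nonneg (norm_nonneg _) (by norm_num)).mp h2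
    have hw2 : (d * μ) ^ 2 - t * (d * μ) + 1 = 0 := by
      linear_combination (d * μ) * hd2 - d * (1 - d) * hμi - hdd
    have hw5 : ‖d * μ‖ = 1 := by
      have : (d * μ) ^ 5 = -1 := by
        generalize d * μ = w at hw2
        have e2 : w ^ 2 = t * w - 1 := by linear_combination hw2
        have e4 : w ^ 4 = w - t := by
          have : w ^ 4 = (w ^ 2) ^ 2 := by ring
          rw [this, e2]
          linear_combination (t : ℂ) ^ 2 * e2 + ((t : ℂ) * w + w - 1) * hy
        linear_combination w * e4 + e2
      have h2 : ‖d * μ‖ ^ 5 = 1 := by rw [← norm_pow, this]; simp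
      exact (pow_eq_one_iff_of_nonneg (norm_nonneg _) (by norm_num)).mp h2
    rw [norm_mul, hd3, one_mul] at hw5
    linarith
  · simp only [P]
    intro h
    have h1 : d = 0 := by simpa using h
    rw [h1] at hd2
    apply hμr (t⁻¹)
    rw [Complex.ofReal_inv, ← hd2]
    simp

theorem case_hyp (k : ℕ) (a b : Fin k → ℕ) (y z : ℝ) (hy : y ^ 2 = y + 1)
    (h0 : trP 1 (y : ℂ) (z : ℂ) (syl k a b) = 0) (hz : 2 < y + z ^ 2 - y * z) :
    ∃ H : Subgroup (TriGroup k a b), Nonempty (H ≃* FreeGroup (Fin 2)) := by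
  obtain ⟨m, hm1, hm⟩ : ∃ m : ℝ, 1 < m ∧ m ^ 2 + 1 = (y + z ^ 2 - y * z) * m := by
    set κ := y + z ^ 2 - y * z with hκ
    have h4 : 0 ≤ κ ^ 2 - 4 := by nlinarith
    refine ⟨(κ + Real.sqrt (κ ^ 2 - 4)) / 2, ?_, ?_⟩
    · have := Real.sqrt_nonneg (κ ^ 2 - 4); linarith
    · have := Real.sq_sqrt h4
      linear_combination this / 4
  have hyC : (y : ℂ) ^ 2 = y + 1 := by exact_mod_cast hy
  have hmC : (m : ℂ) ^ 2 + 1 = ((y : ℂ) + z ^ 2 - y * z) * m := by exact_mod_cast hm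
  have n0 : (m : ℂ) ≠ 0 := by exact_mod_cast (by linarith : m ≠ 0)
  have n1 : (m : ℂ) + 1 ≠ 0 := by exact_mod_cast (by linarith : m + 1 ≠ 0)
  have n2 : (m : ℂ) ^ 2 + m + 1 ≠ 0 := by
    exact_mod_cast (by nlinarith : m ^ 2 + m + 1 ≠ 0)
  have hnorm : 1 < ‖(m : ℂ)‖ := by
    rw [Complex.norm_real, Real.norm_eq_abs, abs_of_pos (by linarith)]; exact hm1
  generalize (m : ℂ) = μ at *
  generalize (y : ℂ) = y at *
  generalize (z : ℂ) = z at *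
  obtain ⟨w, hw0⟩ : ∃ w : ℂ, w = z * (μ + 1) - y * μ := ⟨_, rfl⟩
  obtain ⟨N, hN⟩ : ∃ N : ℂ, N = μ ^ 2 + μ + 1 := ⟨_, rfl⟩
  rw [← hN] at n2
  have key : y ^ 2 * N + w * y * (μ - 1) + w ^ 2
      = (μ + 1) ^ 2 * (z ^ 2 - z * y + y ^ 2) := by rw [hw0, hN]; ring
  have key2 : μ * (z ^ 2 - z * y + y ^ 2) = N := by
    linear_combination μ * hyC - hmC - hN
  obtain ⟨e, he⟩ : ∃ e : ℂ, e * (μ + 1) = 1 := ⟨(μ + 1)⁻¹, inv_mul_cancel₀ n1⟩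
  obtain ⟨f, hf⟩ : ∃ f : ℂ, f * N = 1 := ⟨N⁻¹, inv_mul_cancel₀ n2⟩
  obtain ⟨v, hv⟩ : ∃ v : ℂ, v * μ = 1 := ⟨μ⁻¹, inv_mul_cancel₀ n0⟩
  have hvi : μ⁻¹ = v := inv_eq_of_mul_eq_one_left hv
  have e0 : e ≠ 0 := left_ne_zero_of_mul_eq_one he
  let P : SpecialLinearGroup (Fin 2) ℂ := ⟨!![μ * e, 1; -N * e ^ 2, e], by
    rw [Matrix.det_fin_two_of]
    linear_combination e ^ 2 * hN + (e * (μ + 1) + 1) * he⟩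
  let Q : SpecialLinearGroup (Fin 2) ℂ := ⟨!![y * e, - w * f;
      μ * ((μ - 1) * y + w) * e ^ 2, μ * y * e], by
    rw [Matrix.det_fin_two_of]
    linear_combination f * e ^ 2 * (μ * key + (μ + 1) ^ 2 * key2) - μ * y ^ 2 * e ^ 2 * hf + hf * (e * (μ + 1)) ^ 2 + (e * (μ + 1) + 1) * he⟩
  let g : SpecialLinearGroup (Fin 2) ℂ := ⟨!![μ, 0; 0, v], by
    rw [Matrix.det_fin_two_of]; linear_combination hv⟩
  have hg : P * Q = g * (Q * P) := by
    apply slext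
    rw [Matrix.SpecialLinearGroup.coe_mul, Matrix.SpecialLinearGroup.coe_mul,
      Matrix.SpecialLinearGroup.coe_mul]
    simp only [P, Q, g, Matrix.mul_fin_two]
    ext i j
    fin_cases i <;> fin_cases j <;> simp
    · linear_combination -(μ * e ^ 2 * w) * hf
    · ring
    · linear_combination -e ^ 3 * (μ * ((μ - 1) * y + w) - y * N) * hv
    · linear_combination e ^ 2 * w * hf - e ^ 2 * (μ * y + w) * hv
  have hw : wEval P Q (xgen * ygen * (ygen * xgen)⁻¹) = g := by
    have : wEval P Q (xgen * ygen * (ygen * xgen)⁻¹) = P * Q * (Q * P)⁻¹ := by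
      simp [wEval, xgen, ygen]
    rw [this, hg, mul_inv_cancel_right]
  refine finish k a b P Q y z hyC ?_ ?_ ?_ h0 _ μ hnorm
    (by rw [hw]; simp [g]) (by rw [hw]; simp [g]) (by rw [hw]; simp [g]) (by rw [hw, hvi]; simp [g])
    ?_ ?_ ?_ ?_
  · simp only [P, Matrix.trace_fin_two_of]; linear_combination he
  · simp only [Q, Matrix.trace_fin_two_of]; linear_combination y * he
  · rw [Matrix.SpecialLinearGroup.coe_mul]
    simp only [P, Q, Matrix.mul_fin_two, Matrix.trace_fin_two_of]
    linear_combination e ^ 2 * w * hf + e * (μ * y + w) * he + e * hw0 + z * he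
  · simp [P, n0, e0]
  · simp [P]
  · simp [P, n2, e0]
  · simp [P, e0]

theorem pow_fifth (w y : ℂ) (hy : y ^ 2 = y + 1) (hw : w ≠ 0) (h : w + w⁻¹ = y) : w ^ 5 = -1 := by
  have e2 : w ^ 2 = y * w - 1 := by rw [← h]; field_simp; ring
  have e4 : w ^ 4 = w - y := by
    have : w ^ 4 = (w ^ 2) ^ 2 := by ring
    rw [this, e2]
    linear_combination y ^ 2 * e2 + (y * w + w - 1) * hy
  linear_combination w * e4 + e2

theorem pow_third (w : ℂ) (hw : w ≠ 0) (h : w + w⁻¹ = 1) : w ^ 3 = -1 := by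
  have e2 : w ^ 2 = w - 1 := by
    have : w * (w + w⁻¹) = w := by rw [h, mul_one]
    rw [mul_add, mul_inv_cancel₀ hw] at this
    linear_combination this
  linear_combination (w + 1) * e2

theorem not_reducible' (l : List (ℕ × ℕ)) (a b y : ℂ) (hy : y ^ 2 = y + 1) (ha0 : a ≠ 0)
    (hb0 : b ≠ 0) (ha : a + a⁻¹ = 1) (hb : b + b⁻¹ = y)
    (h0 : trP 1 y (a * b + (a * b)⁻¹) l = 0) : False := by
  have key : ∀ l, ∃ w : ℂ, w ^ 30 = 1 ∧ wM (Matrix.diagonal ![a, a⁻¹]) (Matrix.diagonal ![b, b⁻¹]) l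
      = Matrix.diagonal ![w, w⁻¹] := by
    intro l
    induction l with
    | nil =>
      refine ⟨1, by simp, ?_⟩
      rw [wM, ← Matrix.diagonal_one]
      congr 1; ext i; fin_cases i <;> simp
    | cons s l ih =>
      obtain ⟨w, hw, h⟩ := ih
      refine ⟨a ^ s.1 * b ^ s.2 * w, ?_, ?_⟩
      · have ha30 : a ^ 30 = 1 := by
          rw [show (30 : ℕ) = 3 * 10 from rfl, pow_mul, pow_third a ha0 ha]; norm_num
        have hb30 : b ^ 30 = 1 := by
          rw [show (30 : ℕ) = 5 * 6 from rfl, pow_mul, pow_fifth b y hy hb0 hb]; norm_num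
        rw [mul_pow, mul_pow, hw, ← pow_mul, ← pow_mul, mul_comm s.1, mul_comm s.2, pow_mul,
          pow_mul, ha30, hb30]
        simp
      · rw [wM, h, Matrix.diagonal_pow, Matrix.diagonal_pow, Matrix.diagonal_mul_diagonal,
          Matrix.diagonal_mul_diagonal]
        congr 1; ext i; fin_cases i
        · simp
        · simp; ring
  obtain ⟨w, hw, h⟩ := key l
  have ht := tr_wM (Matrix.diagonal ![a, a⁻¹]) (Matrix.diagonal ![b, b⁻¹])
    (by simp [ha0]) (by simp [hb0]) l
  rw [Matrix.diagonal_mul_diagonal, h] at ht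
  simp only [Matrix.trace_diagonal, Fin.sum_univ_two, Matrix.cons_val_zero, Matrix.cons_val_one,
    ha, hb] at ht
  rw [← mul_inv, h0] at ht
  have hw0 : w ≠ 0 := by
    rintro rfl
    norm_num at hw
  have h2 : w ^ 2 = -1 := by
    have : w * (w + w⁻¹) = 0 := by rw [ht, mul_zero]
    rw [mul_add, mul_inv_cancel₀ hw0] at this
    linear_combination this
  rw [show (30 : ℕ) = 2 * 15 from rfl, pow_mul, h2] at hw
  norm_num at hw

theorem not_reducible (l : List (ℕ × ℕ)) (y z : ℂ) (hy : y ^ 2 = y + 1)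
    (hz : y + z ^ 2 - y * z = 2) (h0 : trP 1 y z l = 0) : False := by
  obtain ⟨a, ha0, ha⟩ := ex_quad 1
  obtain ⟨b, hb0, hb⟩ := ex_quad y
  have hai : a * a⁻¹ = 1 := mul_inv_cancel₀ ha0
  have hbi : b * b⁻¹ = 1 := mul_inv_cancel₀ hb0
  have hprod : (z - (a * b + (a * b)⁻¹)) * (z - (a * b⁻¹ + (a * b⁻¹)⁻¹)) = 0 := by
    rw [mul_inv, mul_inv, inv_inv]
    generalize a⁻¹ = a' at *
    generalize b⁻¹ = b' at *
    obtain rfl : a' = 1 - a := by linear_combination ha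
    obtain rfl : b' = y - b := by linear_combination hb
    have e1 : a * a = a - 1 := by linear_combination -hai
    have e2 : b * b = y * b - 1 := by linear_combination -hbi
    have A : ∀ T : ℂ, T * (a * a) = T * (a - 1) := fun T => by rw [e1]
    grind
  rcases mul_eq_zero.mp hprod with h | h
  · rw [sub_eq_zero.mp h] at h0
    exact not_reducible' l a b y hy ha0 hb0 ha hb h0
  · rw [sub_eq_zero.mp h] at h0
    exact not_reducible' l a b⁻¹ y hy ha0 (inv_ne_zero hb0) ha (by rw [inv_inv, add_comm, hb]) h0

theorem small (y z : ℝ) (hy : y ^ 2 = y + 1) (hz : y + z ^ 2 - y * z < 2) :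
    |z * (y - z) * (z * (y - z) - y + 1) * y ^ 2| < 1 := by
  have hu1 : y - 2 < z * (y - z) := by linarith
  have hu2 : z * (y - z) ≤ (y + 1) / 4 := by nlinarith [sq_nonneg (z - y / 2)]
  have hy2 : y < 2 := by nlinarith
  have hy3 : -1 < y := by nlinarith
  generalize z * (y - z) = u at hu1 hu2
  have e : y ^ 2 * (2 - y) = 1 := by rw [hy]; linear_combination -hy
  have f1 : u * (u - y + 1) < 2 - y := by nlinarith [mul_pos (sub_pos.mpr hu1) (by linarith : 0 < 1 - u)]
  have f2 : -(2 - y) < u * (u - y + 1) := by nlinarith [sq_nonneg (2 * u - y + 1)]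
  have yp : 0 < y ^ 2 := by rw [hy]; linarith
  rw [abs_lt]
  constructor <;> nlinarith

end TriAux
namespace TriAux

theorem trP_zero (k : ℕ) (a b : Fin k → ℕ) (τ : Polynomial ℂ)
    (hτ : IsTracePolynomial (Wword k a b) τ) (lam0 : ℂ) (hroot : τ.IsRoot lam0) :
    trP 1 ((1 + (Real.sqrt 5 : ℂ)) / 2) lam0 (syl k a b) = 0 := by
  obtain ⟨p, hp0, hp⟩ := ex_quad 1
  obtain ⟨q, hq0, hq⟩ := ex_quad ((1 + (Real.sqrt 5 : ℂ)) / 2)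
  let P : SpecialLinearGroup (Fin 2) ℂ := ⟨!![p, 1; 0, p⁻¹], by
    rw [Matrix.det_fin_two_of, mul_inv_cancel₀ hp0]; ring⟩
  let Q : SpecialLinearGroup (Fin 2) ℂ := ⟨!![q, 0; lam0 - p * q - p⁻¹ * q⁻¹, q⁻¹], by
    rw [Matrix.det_fin_two_of, mul_inv_cancel₀ hq0]; ring⟩
  have tP : Matrix.trace (P : Matrix (Fin 2) (Fin 2) ℂ) = 1 := by
    simp only [P, Matrix.trace_fin_two_of]; exact hp
  have tQ : Matrix.trace (Q : Matrix (Fin 2) (Fin 2) ℂ) = (1 + (Real.sqrt 5 : ℂ)) / 2 := by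
    simp only [Q, Matrix.trace_fin_two_of]; exact hq
  have tPQ : Matrix.trace ((P * Q : SpecialLinearGroup (Fin 2) ℂ) : Matrix (Fin 2) (Fin 2) ℂ)
      = lam0 := by
    rw [Matrix.SpecialLinearGroup.coe_mul]
    simp only [P, Q, Matrix.mul_fin_two, Matrix.trace_fin_two_of]
    ring
  have h := hτ P Q tP tQ
  rw [tr_wEval, tP, tQ, tPQ, hroot.eq_zero] at h
  exact h

theorem ex_emb (K : Type) [Field K] [NumberField K] (η : K) (hi : IsIntegral ℤ η) (h0 : η ≠ 0) :
    ∃ σ : K →+* ℂ, 1 ≤ ‖σ η‖ := by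
  have hne : (⟨η, hi⟩ : NumberField.RingOfIntegers K) ≠ 0 := by
    intro h
    exact h0 (congrArg Subtype.val h)
  exact NumberField.exists_conjugate_one_le_norm hne

theorem main (k : ℕ) (hk : 1 ≤ k) (a b : Fin k → ℕ)
    (ha : ∀ i, 0 < a i ∧ a i < 3) (hb : ∀ i, 0 < b i ∧ b i < 5) (y l : ℂ) (hy : y ^ 2 = y + 1)
    (h0 : trP 1 y l (syl k a b) = 0) (h1 : l ≠ 0) (h2 : l ≠ 1) (h3 : l ≠ y) (h4 : l ≠ y - 1) :
    ∃ H : Subgroup (TriGroup k a b), Nonempty (H ≃* FreeGroup (Fin 2)) := by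
  obtain ⟨iy, il⟩ := integral_root y l hy (syl k a b) (by
      intro s hs
      rw [syl, List.mem_ofFn] at hs
      obtain ⟨i, rfl⟩ := hs
      exact ⟨ha i, hb i⟩) (by
      intro h
      have := congrArg List.length h
      simp [syl] at this
      omega) h0
  let K := IntermediateField.adjoin ℚ ({y, l} : Set ℂ)
  have fd : FiniteDimensional ℚ K := by
    apply IntermediateField.finiteDimensional_adjoin
    intro x hx
    rcases hx with rfl | rfl
    · exact iy.tower_top
    · exact il.tower_top
  have nf : NumberField K := { to_charZero := inferInstance, to_finiteDimensional := fd }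
  let yK : K := ⟨y, IntermediateField.subset_adjoin _ _ (by simp)⟩
  let lK : K := ⟨l, IntermediateField.subset_adjoin _ _ (by simp)⟩
  let ι : K →+* ℂ := algebraMap K ℂ
  have hι : Function.Injective ι := ι.injective
  have ey : ι yK = y := rfl
  have el : ι lK = l := rfl
  have hyK : yK ^ 2 = yK + 1 := by
    apply hι; simp only [map_pow, map_add, map_one, ey, hy]
  have h0K : trP 1 yK lK (syl k a b) = 0 := by
    apply hι; rw [map_trP, ey, el, map_one, map_zero, h0]
  have iyK : IsIntegral ℤ yK := by
    rw [← isIntegral_algHom_iff (ι.toIntAlgHom) hι]; exact iy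
  have ilK : IsIntegral ℤ lK := by
    rw [← isIntegral_algHom_iff (ι.toIntAlgHom) hι]; exact il
  have ηi : IsIntegral ℤ (lK * (yK - lK) * (lK * (yK - lK) - yK + 1) * yK ^ 2) :=
    ((ilK.mul (iyK.sub ilK)).mul (((ilK.mul (iyK.sub ilK)).sub iyK).add isIntegral_one)).mul
      (iyK.pow 2)
  have η0 : lK * (yK - lK) * (lK * (yK - lK) - yK + 1) * yK ^ 2 ≠ 0 := by
    intro h
    have h' := congrArg ι h
    simp only [map_mul, map_sub, map_add, map_pow, map_one, map_zero, ey, el] at h'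
    have hy0 : y ≠ 0 := by rintro rfl; norm_num at hy
    have h5 : l * (y - l) - y + 1 = -((l - 1) * (l - (y - 1))) := by ring
    rw [h5] at h'
    simp [hy0, h1, sub_eq_zero, h2, h4, Ne.symm h3] at h'
  obtain ⟨σ, hσ⟩ := ex_emb K _ ηi η0
  have hy' : (σ yK) ^ 2 = σ yK + 1 := by
    have := congrArg σ hyK
    simpa using this
  have h0' : trP 1 (σ yK) (σ lK) (syl k a b) = 0 := by
    have := congrArg σ h0K
    rwa [map_trP, map_one, map_zero] at this
  simp only [map_mul, map_sub, map_add, map_pow, map_one] at hσ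
  generalize σ yK = Y at *
  generalize σ lK = Z at *
  by_cases hz : Z.im = 0
  · obtain ⟨t, rfl, ht⟩ := real_y Y hy'
    obtain ⟨z, rfl⟩ : ∃ z : ℝ, Z = z := ⟨Z.re, Complex.ext (by simp) (by simp [hz])⟩
    rcases lt_trichotomy (t + z ^ 2 - t * z) 2 with h | h | h
    · exfalso
      have hs := small t z ht h
      have : ‖((z * (t - z) * (z * (t - z) - t + 1) * t ^ 2 : ℝ) : ℂ)‖ < 1 := by
        rw [Complex.norm_real, Real.norm_eq_abs]; exact hs
      push_cast at this
      linarith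
    · exact (not_reducible _ _ _ hy' (by exact_mod_cast h) h0').elim
    · exact case_hyp k a b t z ht h0' h
  · exact case_nonreal k a b Y Z hy' h0' hz

end TriAux
/-- **Lemma 1**: if the trace polynomial of `W` has a root outside
`{0, 1, (1+√5)/2, (−1+√5)/2}`, then the generalised triangle group
`⟨x, y ∣ x³ = y⁵ = W² = 1⟩` of type (3,5,2) contains a nonabelian free subgroup. -/
theorem trigroup_free_of_root_outside
    (k : ℕ) (hk : 1 ≤ k) (a b : Fin k → ℕ)
    (ha : ∀ i, 0 < a i ∧ a i < 3) (hb : ∀ i, 0 < b i ∧ b i < 5)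
    (τ : Polynomial ℂ) (hτ : IsTracePolynomial (Wword k a b) τ)
    (lam0 : ℂ) (hroot : τ.IsRoot lam0)
    (hout : lam0 ∉ ({0, 1, (1 + (Real.sqrt 5 : ℂ)) / 2, (-1 + (Real.sqrt 5 : ℂ)) / 2} : Set ℂ)) :
    ∃ H : Subgroup (TriGroup k a b), Nonempty (H ≃* FreeGroup (Fin 2)) := by
  have h5 : (Real.sqrt 5 : ℂ) ^ 2 = 5 := by
    rw [← Complex.ofReal_pow, Real.sq_sqrt (by norm_num)]; norm_num
  simp only [Set.mem_insert_iff, Set.mem_singleton_iff, not_or] at hout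
  obtain ⟨h1, h2, h3, h4⟩ := hout
  exact TriAux.main k hk a b ha hb _ lam0 (by linear_combination h5 / 4)
    (TriAux.trP_zero k a b τ hτ lam0 hroot) h1 h2 h3
    (by intro h; apply h4; rw [h]; ring)
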